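/- For every a = (a_1, …, a_{n+1}) ∈ ℍ^{n+1}, Σ_{α=1}^{n} ψ_α(a)² + Σ_{1 ≤ k < l ≤ n+1} ( ψ_{kl}(a)² + ψ_{k̄l̄}(a)² + ψ̃_{kl}(a)² + ψ̃_{k̄l̄}(a)² ) = ( Σ_{k=1}^{n+1} |a_k|² )². In particular, the map Φ'(a) = (ψ_α(a); ψ_{kl}(a); ψ_{k̄l̄}(a); ψ̃_{kl}(a); ψ̃_{k̄l̄}(a)) ∈ ℝ^{n(2n+3)} sends the unit sphere S^{4n+3} ⊂ ℍ^{n+1} into the unit sphere of ℝ^{n(2n+3)}. -/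

import Mathlib

open scoped BigOperators Quaternion

/-- Pairs `k < l` of indices in `Fin m`. -/
abbrev SpherePairs (m : ℕ) := {p : Fin m × Fin m // p.1 < p.2}

/-- The constant `c_{n,α}` (with `α` given 1-based). -/
noncomputable def LOc (n α : ℕ) : ℝ :=
  Real.sqrt (((n : ℝ) + 1) * ((n : ℝ) + 1 - α) / ((n : ℝ) * ((n : ℝ) + 2 - α)))

/-- The constant `d_n`. -/
noncomputable def LOd (n : ℕ) : ℝ := Real.sqrt (2 * ((n : ℝ) + 1) / n)

/-- `ψ_α`, for `α : Fin n` representing the 1-based index `α+1`. -/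
noncomputable def psiA (n : ℕ) (α : Fin n) (a : Fin (n + 1) → ℍ[ℝ]) : ℝ :=
  LOc n (α.val + 1) *
    (Quaternion.normSq (a α.castSucc) -
      (1 / ((n : ℝ) - α.val)) *
        ∑ k : Fin (n + 1), if (α.val : ℕ) < k.val then Quaternion.normSq (a k) else 0)

/-- `ψ_{kl} = d_n Re(u_{kl})`, where `conj(a_k)·a_l = u_{kl} + w_{kl}·j`. -/
noncomputable def psiU (n : ℕ) (p : SpherePairs (n + 1)) (a : Fin (n + 1) → ℍ[ℝ]) : ℝ :=
  LOd n * (star (a p.1.1) * a p.1.2).re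

/-- `ψ_{k̄l̄} = d_n Im(u_{kl})`. -/
noncomputable def psiUbar (n : ℕ) (p : SpherePairs (n + 1)) (a : Fin (n + 1) → ℍ[ℝ]) : ℝ :=
  LOd n * (star (a p.1.1) * a p.1.2).imI

/-- `ψ̃_{kl} = d_n Re(w_{kl})`. -/
noncomputable def psiW (n : ℕ) (p : SpherePairs (n + 1)) (a : Fin (n + 1) → ℍ[ℝ]) : ℝ :=
  LOd n * (star (a p.1.1) * a p.1.2).imJ

/-- `ψ̃_{k̄l̄} = d_n Im(w_{kl})`. -/
noncomputable def psiWbar (n : ℕ) (p : SpherePairs (n + 1)) (a : Fin (n + 1) → ℍ[ℝ]) : ℝ :=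
  LOd n * (star (a p.1.1) * a p.1.2).imK

/-- Index type for the `n(2n+3)` functions of Lemma 3.2. -/
abbrev QFamIdx (n : ℕ) :=
  Fin n ⊕ SpherePairs (n + 1) ⊕ SpherePairs (n + 1) ⊕ SpherePairs (n + 1) ⊕ SpherePairs (n + 1)

/-- The family `ψ_α, ψ_{kl}, ψ_{k̄l̄}, ψ̃_{kl}, ψ̃_{k̄l̄}`. -/
noncomputable def qfam (n : ℕ) : QFamIdx n → (Fin (n + 1) → ℍ[ℝ]) → ℝ
  | Sum.inl α => psiA n α
  | Sum.inr (Sum.inl p) => psiU n p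
  | Sum.inr (Sum.inr (Sum.inl p)) => psiUbar n p
  | Sum.inr (Sum.inr (Sum.inr (Sum.inl p))) => psiW n p
  | Sum.inr (Sum.inr (Sum.inr (Sum.inr p))) => psiWbar n p

/-- The map `Φ' : ℍ^{n+1} → ℝ^{n(2n+3)}`. -/
noncomputable def PhiMapII (n : ℕ) (a : Fin (n + 1) → ℍ[ℝ]) : EuclideanSpace ℝ (QFamIdx n) :=
  (WithLp.equiv 2 (QFamIdx n → ℝ)).symm (fun i => qfam n i a)

/-- Twice the sum of the products over pairs `k < l` is the square of the sum minus the sum of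
the squares. -/
theorem two_mul_sum_spherePairs (m : ℕ) (x : Fin m → ℝ) :
    2 * ∑ p : SpherePairs m, x p.1.1 * x p.1.2 = (∑ k, x k) ^ 2 - ∑ k, x k ^ 2 := by
  have hsub : ∑ p : SpherePairs m, x p.1.1 * x p.1.2 =
      ∑ i, ∑ j, if i < j then x i * x j else 0 := by
    rw [← Fintype.sum_prod_type' (f := fun i j => if i < j then x i * x j else 0),
      ← Finset.sum_filter]
    exact (Finset.sum_subtype (Finset.univ.filter fun p : Fin m × Fin m => p.1 < p.2)
      (by simp) fun p => x p.1 * x p.2).symm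
  have hswap : ∑ i, ∑ j, (if i < j then x i * x j else 0) =
      ∑ i, ∑ j, if j < i then x i * x j else 0 := by
    rw [Finset.sum_comm]
    simp only [mul_comm]
  have hdiag : ∑ k, x k ^ 2 = ∑ i, ∑ j, if i = j then x i * x j else 0 := by
    simp [pow_two]
  have hsq : (∑ k, x k) ^ 2 = ∑ i, ∑ j, ((if i < j then x i * x j else 0) +
      (if j < i then x i * x j else 0) + if i = j then x i * x j else 0) := by
    rw [pow_two, Finset.sum_mul_sum]
    refine Finset.sum_congr rfl fun i _ => Finset.sum_congr rfl fun j _ => ?_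
    rcases lt_trichotomy i j with h | h | h
    · simp [h, h.not_gt, h.ne]
    · simp [h]
    · simp [h, h.not_gt, h.ne']
  simp only [Finset.sum_add_distrib] at hsq
  rw [hsq, hdiag, ← hswap, hsub]
  ring

/-- The Helmert-type identity: the weighted squared differences between each entry and the mean
of the later entries add up to the total squared deviation from the mean. -/
theorem sum_sq_sub_tail_mean (n : ℕ) (x : Fin (n + 1) → ℝ) :
    ∑ α : Fin n, ((n : ℝ) - α.val) / ((n : ℝ) + 1 - α.val) *
      (x α.castSucc - (1 / ((n : ℝ) - α.val)) *
        ∑ k : Fin (n + 1), if α.val < k.val then x k else 0) ^ 2 =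
      ∑ k, x k ^ 2 - (∑ k, x k) ^ 2 / (n + 1) := by
  induction n with
  | zero => simp
  | succ n ih =>
    have htail := ih fun k => x k.succ
    have hshift : ∑ α : Fin n, (((n + 1 : ℕ) : ℝ) - α.succ.val) /
          (((n + 1 : ℕ) : ℝ) + 1 - α.succ.val) *
        (x α.succ.castSucc - (1 / (((n + 1 : ℕ) : ℝ) - α.succ.val)) *
          ∑ k : Fin (n + 2), if α.succ.val < k.val then x k else 0) ^ 2 =
        ∑ k : Fin (n + 1), x k.succ ^ 2 - (∑ k : Fin (n + 1), x k.succ) ^ 2 / (n + 1) := by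
      rw [← htail]
      refine Finset.sum_congr rfl fun α _ => ?_
      have h₁ : ((n + 1 : ℕ) : ℝ) - α.succ.val = n - α.val := by
        push_cast [Fin.val_succ]; ring
      have h₂ : ((n + 1 : ℕ) : ℝ) + 1 - α.succ.val = n + 1 - α.val := by
        push_cast [Fin.val_succ]; ring
      rw [h₁, h₂, Fin.sum_univ_succ (n := n + 1)]
      simp
    rw [Fin.sum_univ_succ, hshift, Fin.sum_univ_succ (n := n + 1), Fin.sum_univ_succ (n := n + 1),
      Fin.sum_univ_succ (n := n + 1)]
    simp only [Fin.val_zero, Fin.val_succ, Fin.castSucc_zero, lt_irrefl, Nat.succ_pos, if_true,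
      if_false, Nat.cast_zero, sub_zero, zero_add, Nat.cast_add, Nat.cast_one]
    field_simp
    ring

theorem LOc_succ_sq (n : ℕ) (α : Fin n) :
    LOc n (α.val + 1) ^ 2 =
      ((n : ℝ) + 1) / n * (((n : ℝ) - α.val) / ((n : ℝ) + 1 - α.val)) := by
  have hα : (α.val : ℝ) < n := by exact_mod_cast α.isLt
  have h₁ : (n : ℝ) + 1 - (α.val + 1 : ℕ) = n - α.val := by push_cast; ring
  have h₂ : (n : ℝ) + 2 - (α.val + 1 : ℕ) = n + 1 - α.val := by push_cast; ring
  rw [LOc, h₁, h₂, Real.sq_sqrt, mul_div_mul_comm]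
  have : 0 < (n : ℝ) - α.val := by linarith
  have : 0 < (n : ℝ) + 1 - α.val := by linarith
  positivity

theorem LOd_sq (n : ℕ) : LOd n ^ 2 = 2 * ((n : ℝ) + 1) / n :=
  Real.sq_sqrt (by positivity)

theorem sum_psiA_sq (n : ℕ) (a : Fin (n + 1) → ℍ[ℝ]) :
    ∑ α : Fin n, psiA n α a ^ 2 = ((n : ℝ) + 1) / n *
      (∑ k, Quaternion.normSq (a k) ^ 2 - (∑ k, Quaternion.normSq (a k)) ^ 2 / (n + 1)) := by
  rw [← sum_sq_sub_tail_mean n fun k => Quaternion.normSq (a k), Finset.mul_sum]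
  refine Finset.sum_congr rfl fun α _ => ?_
  rw [psiA, mul_pow, LOc_succ_sq, mul_assoc]

theorem sum_sq_psi_pair (n : ℕ) (p : SpherePairs (n + 1)) (a : Fin (n + 1) → ℍ[ℝ]) :
    psiU n p a ^ 2 + psiUbar n p a ^ 2 + psiW n p a ^ 2 + psiWbar n p a ^ 2 =
      ((n : ℝ) + 1) / n *
        (2 * (Quaternion.normSq (a p.1.1) * Quaternion.normSq (a p.1.2))) := by
  rw [← Quaternion.normSq_star (a p.1.1), ← map_mul, Quaternion.normSq_def', psiU, psiUbar, psiW,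
    psiWbar]
  simp only [mul_pow, LOd_sq]
  ring

theorem sum_psi_sq (n : ℕ) (hn : 1 ≤ n) (a : Fin (n + 1) → ℍ[ℝ]) :
    (∑ α : Fin n, psiA n α a ^ 2) +
        (∑ p : SpherePairs (n + 1),
          (psiU n p a ^ 2 + psiUbar n p a ^ 2 + psiW n p a ^ 2 + psiWbar n p a ^ 2)) =
      (∑ k : Fin (n + 1), Quaternion.normSq (a k)) ^ 2 := by
  have hn₀ : (n : ℝ) ≠ 0 := Nat.cast_ne_zero.mpr (by omega)
  simp only [sum_sq_psi_pair]
  rw [← Finset.mul_sum, ← Finset.mul_sum,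
    two_mul_sum_spherePairs (n + 1) fun k => Quaternion.normSq (a k), sum_psiA_sq]
  field_simp
  ring

theorem norm_PhiMapII_sq (n : ℕ) (a : Fin (n + 1) → ℍ[ℝ]) :
    ‖PhiMapII n a‖ ^ 2 = (∑ α : Fin n, psiA n α a ^ 2) +
        (∑ p : SpherePairs (n + 1),
          (psiU n p a ^ 2 + psiUbar n p a ^ 2 + psiW n p a ^ 2 + psiWbar n p a ^ 2)) := by
  rw [EuclideanSpace.norm_sq_eq]
  simp only [PhiMapII, WithLp.equiv_symm_apply, Real.norm_eq_abs, sq_abs, Fintype.sum_sum_type,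
    qfam, Finset.sum_add_distrib]
  ring

/-- The sum of the squares of the `n(2n+3)` functions equals
`(Σ |a_k|²)²`; in particular `Φ'` maps `S^{4n+3}` into the unit sphere of
`ℝ^{n(2n+3)}`. -/
theorem typeII_sum_of_squares (n : ℕ) (hn : 1 ≤ n) :
    (∀ a : Fin (n + 1) → ℍ[ℝ],
      (∑ α : Fin n, psiA n α a ^ 2) +
        (∑ p : SpherePairs (n + 1),
          (psiU n p a ^ 2 + psiUbar n p a ^ 2 + psiW n p a ^ 2 + psiWbar n p a ^ 2)) =
      (∑ k : Fin (n + 1), Quaternion.normSq (a k)) ^ 2) ∧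
    (∀ a : Fin (n + 1) → ℍ[ℝ],
      (∑ k : Fin (n + 1), Quaternion.normSq (a k)) = 1 → ‖PhiMapII n a‖ = 1) := by
  refine ⟨sum_psi_sq n hn, fun a ha => ?_⟩
  have h : ‖PhiMapII n a‖ ^ 2 = 1 := by
    rw [norm_PhiMapII_sq, sum_psi_sq n hn, ha, one_pow]
  exact (pow_eq_one_iff_of_nonneg (norm_nonneg _) two_ne_zero).mp h
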